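/- (Invariance of the discriminant.) For every homogeneous polynomial F ∈ ℂ[x_0,...,x_n] of degree d and every (n+1)×(n+1) matrix A over ℂ, one has Dis(F(A x)) = det(A)^{d(d−1)^n} · Dis(F(x)), where A x denotes the product of A with the column vector (x_0,...,x_n)^t and F(A x) is the polynomial obtained from F by this linear substitution. -/

import Mathlib

open MvPolynomial

/-- `Mono m e` is the type of exponent vectors of total degree `e` in `m` variables. -/
abbrev Mono (m e : ℕ) : Type := {α : Fin m → ℕ // ∑ j, α j = e}

instance (m e : ℕ) : Fintype (Mono m e) :=
  Fintype.subtype (Finset.Nat.antidiagonalTuple m e) fun _ => Finset.Nat.mem_antidiagonalTuple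

/-- The exponent vector as a finitely supported function (a monomial of `MvPolynomial`). -/
noncomputable abbrev Mono.toFinsupp {m e : ℕ} (α : Mono m e) : Fin m →₀ ℕ :=
  Finsupp.equivFunOnFinite.symm α.1

/-- Evaluation `P ↦ P(F)` of an element `P` of the universal ring of coefficients
`ℂ[u_α : |α| = d]`: each variable `u_α` is replaced by the corresponding coefficient `c_α`
of `F = ∑_{|α| = d} c_α x^α`. -/
noncomputable def disEval {n d : ℕ} (D : MvPolynomial (Mono (n + 1) d) ℂ)
    (F : MvPolynomial (Fin (n + 1)) ℂ) : ℂ :=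
  eval (fun α => coeff α.toFinsupp F) D

/-- `IsDiscriminant n d D` says that `D ∈ ℂ[u_α : |α| = d]` is a discriminant polynomial for
forms of degree `d` on `ℙ^n`: (1) for every homogeneous `F` of degree `d`, the system
`∂F/∂x_0 = ⋯ = ∂F/∂x_n = 0` has a nontrivial solution over `ℂ` (i.e. the hypersurface `V(F)`
is singular) iff `D(F) = 0`; (2) `D` is irreducible. -/
def IsDiscriminant (n d : ℕ) (D : MvPolynomial (Mono (n + 1) d) ℂ) : Prop :=
  (∀ F : MvPolynomial (Fin (n + 1)) ℂ, F.IsHomogeneous d →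
    ((∃ x : Fin (n + 1) → ℂ, x ≠ 0 ∧ ∀ i, eval x (pderiv i F) = 0) ↔ disEval D F = 0)) ∧
  Irreducible D

section Forms

variable {R : Type*} [CommRing R] {σ : Type*} [Fintype σ]

/-- The linear substitution `x_j ↦ ∑_k A_{jk} x_k`. -/
noncomputable def linSubst (A : Matrix σ σ R) : MvPolynomial σ R →ₐ[R] MvPolynomial σ R :=
  aeval fun j => ∑ k, C (A j k) * X k

/-- All the partial derivatives of `F` have a common nontrivial zero. -/
def HasSingularPoint (F : MvPolynomial σ R) : Prop :=
  ∃ x : σ → R, x ≠ 0 ∧ ∀ i, eval x (pderiv i F) = 0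

@[simp]
lemma linSubst_X (A : Matrix σ σ R) (j : σ) : linSubst A (X j) = ∑ k, C (A j k) * X k := by
  simp [linSubst]

@[simp]
lemma linSubst_C (A : Matrix σ σ R) (a : R) : linSubst A (C a) = C a := by
  simp [linSubst]

lemma linSubst_mul (A B : Matrix σ σ R) (F : MvPolynomial σ R) :
    linSubst (A * B) F = linSubst B (linSubst A F) := by
  rw [← AlgHom.comp_apply]
  congr 1
  ext1 j
  simp only [linSubst_X, AlgHom.comp_apply, map_sum, map_mul, linSubst_C, Matrix.mul_apply,
    Finset.sum_mul, Finset.mul_sum, mul_assoc]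
  exact Finset.sum_comm

lemma linSubst_diagonal_X [DecidableEq σ] (s : σ → R) (j : σ) :
    linSubst (Matrix.diagonal s) (X j) = C (s j) * X j := by
  rw [linSubst_X, Finset.sum_eq_single j] <;> simp +contextual [eq_comm]

lemma linSubst_one [DecidableEq σ] (F : MvPolynomial σ R) : linSubst (1 : Matrix σ σ R) F = F := by
  have : linSubst (1 : Matrix σ σ R) = AlgHom.id R _ := by
    ext1 j
    rw [← Matrix.diagonal_one, linSubst_diagonal_X]
    simp
  simp [this]

lemma map_linSubst {S : Type*} [CommRing S] (φ : R →+* S) (A : Matrix σ σ R)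
    (F : MvPolynomial σ R) : map φ (linSubst A F) = linSubst (A.map φ) (map φ F) := by
  induction F using MvPolynomial.induction_on with
  | C a => simp
  | add p q hp hq => simp [hp, hq]
  | mul_X p j hp => simp [hp]

lemma MvPolynomial.IsHomogeneous.linSubst {F : MvPolynomial σ R} {d : ℕ} (hF : F.IsHomogeneous d)
    (A : Matrix σ σ R) : (linSubst A F).IsHomogeneous d := by
  have := hF.aeval (n := 1) (fun j => ∑ k, C (A j k) * X k) fun j =>
    IsHomogeneous.sum _ _ _ fun k _ => by
      simpa using (isHomogeneous_C σ (A j k)).mul (isHomogeneous_X R k)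
  rwa [one_mul] at this

lemma eval_linSubst (A : Matrix σ σ R) (F : MvPolynomial σ R) (x : σ → R) :
    eval x (linSubst A F) = eval (A.mulVec x) F := by
  induction F using MvPolynomial.induction_on with
  | C a => simp
  | add p q hp hq => simp [hp, hq]
  | mul_X p j hp => simp [hp, Matrix.mulVec, dotProduct]

lemma eval_pderiv_linSubst (A : Matrix σ σ R) (F : MvPolynomial σ R) (x : σ → R) (i : σ) :
    eval x (pderiv i (linSubst A F)) = ∑ j, A j i * eval (A.mulVec x) (pderiv j F) := by
  classical
  induction F using MvPolynomial.induction_on with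
  | C a => simp
  | add p q hp hq => simp [hp, hq, mul_add, Finset.sum_add_distrib]
  | mul_X p j hp =>
    simp only [map_mul, pderiv_mul, map_add, eval_linSubst, hp, linSubst_X, map_sum, pderiv_C,
      pderiv_X, mul_add, Finset.sum_add_distrib, eval_X, eval_C, zero_mul, zero_add]
    congr 1
    · rw [Finset.sum_mul]
      refine Finset.sum_congr rfl fun k _ => ?_
      simp [Matrix.mulVec, dotProduct, mul_assoc]
    · rw [Finset.sum_eq_single i, Finset.sum_eq_single j]
      · simp [mul_comm]
      · intro b _ hb
        simp [hb.symm]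
      · simp
      · intro b _ hb
        simp [hb]
      · simp

end Forms

section Field

variable {K : Type*} [Field K] {σ : Type*} [Fintype σ] [DecidableEq σ]

lemma HasSingularPoint.of_linSubst {A : Matrix σ σ K} (hA : A.det ≠ 0) {F : MvPolynomial σ K}
    (h : HasSingularPoint (linSubst A F)) : HasSingularPoint F := by
  obtain ⟨x, hx, h⟩ := h
  refine ⟨A.mulVec x, fun h0 => hA (Matrix.exists_mulVec_eq_zero_iff.1 ⟨x, hx, h0⟩), ?_⟩
  have h0 : A.transpose.mulVec (fun j => eval (A.mulVec x) (pderiv j F)) = 0 := by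
    ext i
    simpa [eval_pderiv_linSubst, Matrix.mulVec, dotProduct] using h i
  intro i
  by_contra hi
  refine hA ?_
  rw [← Matrix.det_transpose]
  exact Matrix.exists_mulVec_eq_zero_iff.1 ⟨_, fun h1 => hi (congrFun h1 i), h0⟩

lemma hasSingularPoint_linSubst_iff {A : Matrix σ σ K} (hA : A.det ≠ 0) {F : MvPolynomial σ K} :
    HasSingularPoint (linSubst A F) ↔ HasSingularPoint F := by
  refine ⟨.of_linSubst hA, fun h => .of_linSubst (A := A⁻¹) ?_ ?_⟩
  · rw [Matrix.det_nonsing_inv, Ring.inverse_eq_inv']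
    exact inv_ne_zero hA
  · rwa [← linSubst_mul, Matrix.mul_nonsing_inv _ (isUnit_iff_ne_zero.2 hA), linSubst_one]

lemma hasSingularPoint_linSubst_of_det_eq_zero {A : Matrix σ σ K} (hA : A.det = 0)
    {F : MvPolynomial σ K} {d : ℕ} (hF : F.IsHomogeneous d) (hd : 2 ≤ d) :
    HasSingularPoint (linSubst A F) := by
  obtain ⟨x, hx, h0⟩ := Matrix.exists_mulVec_eq_zero_iff.2 hA
  refine ⟨x, hx, fun i => ?_⟩
  rw [eval_pderiv_linSubst, h0]
  refine Finset.sum_eq_zero fun j _ => ?_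
  have : eval (0 : σ → K) (pderiv j F) = 0 := by
    rw [eval_zero]
    exact (hF.pderiv (i := j)).coeff_eq_zero (by rw [map_zero]; omega)
  rw [this, mul_zero]

end Field

section Diagonal

variable {R : Type*} [CommRing R] {σ : Type*} [Fintype σ]

/-- The diagonal form `∑_j c_j x_j^d`. -/
noncomputable def diagForm (d : ℕ) (c : σ → R) : MvPolynomial σ R :=
  ∑ j, C (c j) * X j ^ d

lemma isHomogeneous_diagForm (d : ℕ) (c : σ → R) : (diagForm d c).IsHomogeneous d :=
  IsHomogeneous.sum _ _ _ fun j _ => by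
    simpa using (isHomogeneous_C σ (c j)).mul ((isHomogeneous_X R j).pow d)

lemma map_diagForm {S : Type*} [CommRing S] (φ : R →+* S) (d : ℕ) (c : σ → R) :
    map φ (diagForm d c) = diagForm d (φ ∘ c) := by
  simp [diagForm]

lemma linSubst_diagonal_diagForm [DecidableEq σ] (s : σ → R) (d : ℕ) (c : σ → R) :
    linSubst (Matrix.diagonal s) (diagForm d c) = diagForm d fun j => s j ^ d * c j := by
  rw [diagForm, diagForm, map_sum]
  refine Finset.sum_congr rfl fun j _ => ?_
  rw [map_mul, map_pow, linSubst_diagonal_X, linSubst_C, C_mul, C_pow]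
  ring

lemma pderiv_diagForm (d : ℕ) (c : σ → R) (i : σ) :
    pderiv i (diagForm d c) = C (d * c i) * X i ^ (d - 1) := by
  classical
  rw [diagForm, map_sum, Finset.sum_eq_single i]
  · simp only [pderiv_C_mul, pderiv_pow, pderiv_X_self, C_mul, map_natCast]
    ring
  · intro j _ hj
    rw [pderiv_C_mul, pderiv_pow, pderiv_X_of_ne hj, mul_zero, mul_zero]
  · simp

lemma not_hasSingularPoint_diagForm {K : Type*} [Field K] [CharZero K] {d : ℕ} (hd : 2 ≤ d)
    {c : σ → K} (hc : ∀ j, c j ≠ 0) : ¬ HasSingularPoint (diagForm d c) := by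
  rintro ⟨x, hx, h⟩
  refine hx (funext fun i => ?_)
  have hi := h i
  rw [pderiv_diagForm, map_mul, eval_C, map_pow, eval_X, mul_eq_zero, mul_eq_zero,
    Nat.cast_eq_zero, or_iff_right (by simp [hc]; omega)] at hi
  exact eq_zero_of_pow_eq_zero hi

end Diagonal

section Coefficients

variable {R : Type*} [CommRing R] {m e : ℕ}

lemma degree_toFinsupp (α : Mono m e) : Finsupp.degree α.toFinsupp = e := by
  rw [Finsupp.degree_eq_sum]
  exact α.2

lemma toFinsupp_injective : Function.Injective (Mono.toFinsupp : Mono m e → _) := fun _ _ h =>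
  Subtype.ext (Finsupp.equivFunOnFinite.symm.injective h)

/-- The form `∑_{|α| = e} c_α x^α`. -/
noncomputable def formOf (c : Mono m e → R) : MvPolynomial (Fin m) R :=
  ∑ α, monomial α.toFinsupp (c α)

lemma isHomogeneous_formOf (c : Mono m e → R) : (formOf c).IsHomogeneous e :=
  IsHomogeneous.sum _ _ _ fun α _ => isHomogeneous_monomial _ (degree_toFinsupp α)

lemma coeff_formOf (c : Mono m e → R) (α : Mono m e) : coeff α.toFinsupp (formOf c) = c α := by
  classical
  rw [formOf, coeff_sum, Finset.sum_eq_single α]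
  · simp
  · intro β _ h
    rw [coeff_monomial, if_neg (toFinsupp_injective.ne h)]
  · simp

lemma map_formOf {S : Type*} [CommRing S] (φ : R →+* S) (c : Mono m e → R) :
    map φ (formOf c) = formOf (φ ∘ c) := by
  simp [formOf]

lemma formOf_coeff {F : MvPolynomial (Fin m) R} (hF : F.IsHomogeneous e) :
    formOf (fun α : Mono m e => coeff α.toFinsupp F) = F := by
  ext s
  by_cases hs : Finsupp.degree s = e
  · have hs' : ∑ j, s j = e := by rw [← hs, Finsupp.degree_eq_sum]
    have : s = Mono.toFinsupp (⟨s, hs'⟩ : Mono m e) := by ext; rfl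
    rw [this, coeff_formOf]
  · rw [hF.coeff_eq_zero hs, (isHomogeneous_formOf _).coeff_eq_zero hs]

end Coefficients

section Universal

variable {n d : ℕ}

/-- The universal form `∑_{|α| = d} u_α x^α`. -/
noncomputable def universalForm (m e : ℕ) : MvPolynomial (Fin m) (MvPolynomial (Mono m e) ℂ) :=
  formOf X

lemma map_universalForm (c : Mono n d → ℂ) :
    map (aeval c : _ →ₐ[ℂ] ℂ).toRingHom (universalForm n d) = formOf c := by
  rw [universalForm, map_formOf]
  congr 1
  ext α
  simp

lemma disEval_map {R : Type*} [CommRing R] [Algebra ℂ R] (φ : R →ₐ[ℂ] ℂ)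
    (D : MvPolynomial (Mono (n + 1) d) ℂ) (F : MvPolynomial (Fin (n + 1)) R) :
    disEval D (map φ.toRingHom F) = φ (aeval (fun α => coeff α.toFinsupp F) D) := by
  rw [disEval, ← AlgHom.comp_apply, comp_aeval, ← coe_aeval_eq_eval]
  simp [coeff_map]

lemma disEval_formOf (D : MvPolynomial (Mono (n + 1) d) ℂ) (c : Mono (n + 1) d → ℂ) :
    disEval D (formOf c) = eval c D := by
  simp only [disEval, coeff_formOf]

lemma exists_eval_eq_disEval_map (D : MvPolynomial (Mono (n + 1) d) ℂ)
    (F : MvPolynomial (Fin (n + 1)) (Polynomial ℂ)) :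
    ∃ q : Polynomial ℂ, ∀ t, disEval D (map (Polynomial.evalRingHom t) F) = q.eval t :=
  ⟨aeval (fun α => coeff α.toFinsupp F) D, fun t => by
    have := disEval_map (Polynomial.aeval t) D F
    rw [Polynomial.coe_aeval_eq_eval] at this
    exact this⟩

lemma dvd_of_forall_eval_eq_zero {σ : Type*} [Finite σ] {D M : MvPolynomial σ ℂ}
    (hD : Irreducible D) (h : ∀ x, eval x D = 0 → eval x M = 0) : D ∣ M := by
  have hM : M ∈ (Ideal.span {D}).radical := by
    rw [← vanishingIdeal_zeroLocus_eq_radical (K := ℂ), mem_vanishingIdeal_iff]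
    intro x hx
    rw [zeroLocus_span] at hx
    simpa [aeval_eq_eval] using h x (by simpa [aeval_eq_eval] using hx)
  obtain ⟨k, hk⟩ := hM
  exact (UniqueFactorizationMonoid.irreducible_iff_prime.1 hD).dvd_of_dvd_pow
    (Ideal.mem_span_singleton.1 hk)

lemma IsDiscriminant.dvd {D M : MvPolynomial (Mono (n + 1) d) ℂ} (hD : IsDiscriminant n d D)
    (h : ∀ F : MvPolynomial (Fin (n + 1)) ℂ, F.IsHomogeneous d → HasSingularPoint F →
      disEval M F = 0) : D ∣ M := by
  refine dvd_of_forall_eval_eq_zero hD.2 fun c hc => ?_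
  rw [← disEval_formOf] at hc ⊢
  exact h _ (isHomogeneous_formOf c) ((hD.1 _ (isHomogeneous_formOf c)).2 hc)

/-- The action of a linear substitution on the universal ring of coefficients. -/
noncomputable def coeffPullback (A : Matrix (Fin (n + 1)) (Fin (n + 1)) ℂ) :
    MvPolynomial (Mono (n + 1) d) ℂ →ₐ[ℂ] MvPolynomial (Mono (n + 1) d) ℂ :=
  aeval fun α => coeff α.toFinsupp (linSubst (A.map C) (universalForm (n + 1) d))

lemma disEval_coeffPullback (A : Matrix (Fin (n + 1)) (Fin (n + 1)) ℂ)
    (P : MvPolynomial (Mono (n + 1) d) ℂ) {F : MvPolynomial (Fin (n + 1)) ℂ}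
    (hF : F.IsHomogeneous d) : disEval (coeffPullback A P) F = disEval P (linSubst A F) := by
  set c : Mono (n + 1) d → ℂ := fun α => coeff α.toFinsupp F with hc
  have hmap : map (aeval c : _ →ₐ[ℂ] ℂ).toRingHom
      (linSubst (A.map C) (universalForm (n + 1) d)) = linSubst A F := by
    rw [map_linSubst, map_universalForm, formOf_coeff hF]
    congr 2
    ext i j
    simp
  rw [← hmap, disEval_map]
  rfl

lemma coeffPullback_coeffPullback {A B : Matrix (Fin (n + 1)) (Fin (n + 1)) ℂ} (h : A * B = 1)
    (P : MvPolynomial (Mono (n + 1) d) ℂ) : coeffPullback A (coeffPullback B P) = P := by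
  refine MvPolynomial.funext fun c => ?_
  have hc := isHomogeneous_formOf c
  rw [← disEval_formOf, ← disEval_formOf, disEval_coeffPullback _ _ hc,
    disEval_coeffPullback _ _ (hc.linSubst A), ← linSubst_mul, h, linSubst_one]

lemma IsDiscriminant.dvd_coeffPullback {D : MvPolynomial (Mono (n + 1) d) ℂ}
    (hD : IsDiscriminant n d D) {A : Matrix (Fin (n + 1)) (Fin (n + 1)) ℂ} (hA : A.det ≠ 0) :
    D ∣ coeffPullback A D := by
  refine hD.dvd fun F hF hs => ?_
  rw [disEval_coeffPullback _ _ hF]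
  exact (hD.1 _ (hF.linSubst A)).1 ((hasSingularPoint_linSubst_iff hA).2 hs)

lemma IsDiscriminant.exists_disEval_linSubst {D : MvPolynomial (Mono (n + 1) d) ℂ}
    (hD : IsDiscriminant n d D) {A : Matrix (Fin (n + 1)) (Fin (n + 1)) ℂ} (hA : A.det ≠ 0) :
    ∃ c : ℂ, ∀ F : MvPolynomial (Fin (n + 1)) ℂ, F.IsHomogeneous d →
      disEval D (linSubst A F) = c * disEval D F := by
  have hA' : A⁻¹.det ≠ 0 := by
    rw [Matrix.det_nonsing_inv, Ring.inverse_eq_inv']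
    exact inv_ne_zero hA
  have hAA := Matrix.mul_nonsing_inv A (isUnit_iff_ne_zero.2 hA)
  have hAA' := Matrix.nonsing_inv_mul A (isUnit_iff_ne_zero.2 hA)
  obtain ⟨E, hE⟩ := hD.dvd_coeffPullback hA
  obtain ⟨E', hE'⟩ := hD.dvd_coeffPullback hA'
  have h1 : coeffPullback A⁻¹ E * E' = 1 := by
    have := coeffPullback_coeffPullback hAA' D
    rw [hE, map_mul, hE', mul_assoc] at this
    rw [mul_comm]
    exact mul_left_cancel₀ hD.2.ne_zero (by rw [this, mul_one])
  have hunit : IsUnit E := by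
    rw [← coeffPullback_coeffPullback hAA E]
    exact (IsUnit.of_mul_eq_one _ h1).map _
  obtain ⟨c, -, rfl⟩ := isUnit_iff_eq_C_of_isReduced.1 hunit
  refine ⟨c, fun F hF => ?_⟩
  rw [← disEval_coeffPullback _ _ hF, hE]
  simp [disEval, mul_comm]

end Universal

section Macaulay

variable {R : Type*} [CommRing R] {n d : ℕ}

/-- The degree in which Macaulay's matrix of the partial derivatives is formed. -/
def macaulayDegree (n d : ℕ) : ℕ := (n + 1) * (d - 2) + 1

open Classical in
/-- The partial derivative used in the row `α` of Macaulay's matrix; `i` is chosen only if no other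
variable is available. -/
noncomputable def macaulayIndex (d : ℕ) (i : Fin (n + 1)) (α : Fin (n + 1) → ℕ) : Fin (n + 1) :=
  if h : ∃ j ≠ i, d - 1 ≤ α j then h.choose else i

lemma le_apply_macaulayIndex (hd : 2 ≤ d) (i : Fin (n + 1))
    (α : Mono (n + 1) (macaulayDegree n d)) : d - 1 ≤ α.1 (macaulayIndex d i α.1) := by
  unfold macaulayIndex
  split_ifs with h
  · exact h.choose_spec.2
  · by_contra! hi
    push Not at h
    have hle : ∑ j, α.1 j ≤ ∑ _j : Fin (n + 1), (d - 2) := by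
      refine Finset.sum_le_sum fun j _ => ?_
      by_cases hj : j = i
      · subst hj; omega
      · have := h j hj; omega
    rw [α.2] at hle
    simp [macaulayDegree] at hle

lemma lt_of_macaulayIndex_eq {i : Fin (n + 1)} {α : Fin (n + 1) → ℕ}
    (h : macaulayIndex d i α = i) {j : Fin (n + 1)} (hj : j ≠ i) : α j < d - 1 := by
  unfold macaulayIndex at h
  split_ifs at h with h'
  · exact absurd h h'.choose_spec.1
  · push Not at h'
    exact h' j hj

lemma card_macaulayIndex_eq_le (e : ℕ) (i : Fin (n + 1)) :
    (Finset.univ.filter fun α : Mono (n + 1) e => macaulayIndex d i α.1 = i).card ≤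
      (d - 1) ^ n := by
  classical
  have hcard : Fintype.card (Fin n → Fin (d - 1)) = (d - 1) ^ n := by simp
  rw [← hcard, ← Fintype.card_coe]
  refine Fintype.card_le_of_injective
    (fun α j => ⟨α.1.1 (i.succAbove j),
      lt_of_macaulayIndex_eq (Finset.mem_filter.1 α.2).2 (i.succAbove_ne j)⟩) ?_
  intro α β h
  have h' : ∀ j, α.1.1 (i.succAbove j) = β.1.1 (i.succAbove j) := fun j =>
    congrArg Fin.val (congrFun h j)
  have hα := α.1.2
  have hβ := β.1.2
  rw [Fin.sum_univ_succAbove _ i] at hα hβ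
  simp only [h'] at hα
  refine Subtype.ext (Subtype.ext (funext fun k => ?_))
  rcases Fin.eq_self_or_eq_succAbove i k with rfl | ⟨j, rfl⟩
  · omega
  · exact h' j

/-- The row `α` of Macaulay's matrix, as a form: a monomial multiple of a partial derivative. -/
noncomputable def macaulayRow (d : ℕ) (i : Fin (n + 1)) (F : MvPolynomial (Fin (n + 1)) R)
    (α : Mono (n + 1) (macaulayDegree n d)) : MvPolynomial (Fin (n + 1)) R :=
  monomial (α.toFinsupp - Finsupp.single (macaulayIndex d i α.1) (d - 1)) 1 *
    pderiv (macaulayIndex d i α.1) F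

/-- Macaulay's matrix of the partial derivatives of `F`. -/
noncomputable def macaulayMatrix (d : ℕ) (i : Fin (n + 1)) (F : MvPolynomial (Fin (n + 1)) R) :
    Matrix (Mono (n + 1) (macaulayDegree n d)) (Mono (n + 1) (macaulayDegree n d)) R :=
  Matrix.of fun α γ => coeff γ.toFinsupp (macaulayRow d i F α)

lemma single_le_toFinsupp (hd : 2 ≤ d) (i : Fin (n + 1))
    (α : Mono (n + 1) (macaulayDegree n d)) :
    Finsupp.single (macaulayIndex d i α.1) (d - 1) ≤ α.toFinsupp := by
  rw [Finsupp.single_le_iff]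
  exact le_apply_macaulayIndex hd i α

lemma isHomogeneous_macaulayRow (hd : 2 ≤ d) (i : Fin (n + 1))
    {F : MvPolynomial (Fin (n + 1)) R} (hF : F.IsHomogeneous d)
    (α : Mono (n + 1) (macaulayDegree n d)) :
    (macaulayRow d i F α).IsHomogeneous (macaulayDegree n d) := by
  have h := congrArg (Finsupp.degree (R := ℕ)) (tsub_add_cancel_of_le (single_le_toFinsupp hd i α))
  rw [map_add, degree_toFinsupp, Finsupp.degree_single] at h
  rw [← h]
  exact (isHomogeneous_monomial _ rfl).mul hF.pderiv

lemma map_macaulayMatrix {S : Type*} [CommRing S] (φ : R →+* S) (i : Fin (n + 1))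
    (F : MvPolynomial (Fin (n + 1)) R) :
    (macaulayMatrix d i F).map φ = macaulayMatrix d i (map φ F) := by
  ext α γ
  simp [macaulayMatrix, macaulayRow, pderiv_map, ← coeff_map]

lemma det_macaulayMatrix_eq_zero {K : Type*} [Field K] (hd : 2 ≤ d) (i : Fin (n + 1))
    {F : MvPolynomial (Fin (n + 1)) K} (hF : F.IsHomogeneous d) (hs : HasSingularPoint F) :
    (macaulayMatrix d i F).det = 0 := by
  obtain ⟨x, hx, h⟩ := hs
  refine Matrix.exists_mulVec_eq_zero_iff.1 ⟨fun γ => eval x (monomial γ.toFinsupp 1), ?_, ?_⟩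
  · obtain ⟨j, hj⟩ := Function.ne_iff.1 hx
    refine Function.ne_iff.2 ⟨⟨Pi.single j (macaulayDegree n d), by simp⟩, ?_⟩
    have : Mono.toFinsupp (⟨Pi.single j (macaulayDegree n d), by simp⟩ :
        Mono (n + 1) (macaulayDegree n d)) = Finsupp.single j (macaulayDegree n d) := by
      ext k
      simp [Finsupp.single_apply, Pi.single_apply, eq_comm]
    rw [this]
    simpa [eval_monomial] using fun h => absurd h hj
  · ext α
    have hrow := congrArg (eval x) (formOf_coeff (isHomogeneous_macaulayRow hd i hF α))
    rw [formOf, map_sum, macaulayRow, map_mul, h, mul_zero] at hrow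
    rw [Pi.zero_apply, ← hrow, Matrix.mulVec, dotProduct]
    refine Finset.sum_congr rfl fun γ _ => ?_
    simp [macaulayMatrix, macaulayRow, eval_monomial]

lemma macaulayMatrix_diagForm (hd : 2 ≤ d) (i : Fin (n + 1)) (c : Fin (n + 1) → R) :
    macaulayMatrix d i (diagForm d c) =
      Matrix.diagonal fun α => (d : R) * c (macaulayIndex d i α.1) := by
  classical
  ext α γ
  have : macaulayRow d i (diagForm d c) α =
      monomial α.toFinsupp ((d : R) * c (macaulayIndex d i α.1)) := by
    rw [macaulayRow, pderiv_diagForm, X_pow_eq_monomial, C_mul_monomial, monomial_mul,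
      tsub_add_cancel_of_le (single_le_toFinsupp hd i α), one_mul, mul_one]
  rw [macaulayMatrix, Matrix.of_apply, this, coeff_monomial, Matrix.diagonal_apply]
  simp only [toFinsupp_injective.eq_iff]

end Macaulay

section Exponent

variable {n d : ℕ} {D : MvPolynomial (Mono (n + 1) d) ℂ}

lemma Polynomial.exists_eq_C_mul_X_pow {K : Type*} [Field K] [IsAlgClosed K] {p : Polynomial K}
    (h : ∀ s, s ≠ 0 → p.eval s ≠ 0) :
    ∃ k : K, k ≠ 0 ∧ ∃ m : ℕ, p = Polynomial.C k * Polynomial.X ^ m := by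
  have hp : p ≠ 0 := by
    rintro rfl
    exact h 1 one_ne_zero (by simp)
  obtain ⟨q, hq, hq0⟩ := p.exists_eq_pow_rootMultiplicity_mul_and_not_dvd hp 0
  rw [Polynomial.dvd_iff_isRoot] at hq0
  have hdeg : q.degree = 0 := by
    by_contra hdeg
    obtain ⟨s, hs⟩ := IsAlgClosed.exists_root q hdeg
    refine h s (fun h0 => hq0 (h0 ▸ hs)) ?_
    rw [hq, Polynomial.eval_mul, hs.eq_zero, mul_zero]
  rw [Polynomial.eq_C_of_degree_eq_zero hdeg] at hq
  refine ⟨q.coeff 0, fun h0 => hp ?_, p.rootMultiplicity 0, ?_⟩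
  · rw [hq, h0, Polynomial.C_0, mul_zero]
  · rwa [Polynomial.C_0, sub_zero, mul_comm] at hq

lemma IsDiscriminant.disEval_ne_zero (hD : IsDiscriminant n d D)
    {F : MvPolynomial (Fin (n + 1)) ℂ} (hF : F.IsHomogeneous d) (h : ¬ HasSingularPoint F) :
    disEval D F ≠ 0 := fun h0 => h ((hD.1 F hF).2 h0)

lemma IsDiscriminant.disEval_diagForm_ne_zero (hD : IsDiscriminant n d D) (hd : 2 ≤ d)
    {c : Fin (n + 1) → ℂ} (hc : ∀ j, c j ≠ 0) : disEval D (diagForm d c) ≠ 0 :=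
  hD.disEval_ne_zero (isHomogeneous_diagForm d c) (not_hasSingularPoint_diagForm hd hc)

lemma IsDiscriminant.disEval_linSubst_transvection (hD : IsDiscriminant n d D) (hd : 2 ≤ d)
    {i j : Fin (n + 1)} (hij : i ≠ j) (t : ℂ) {F : MvPolynomial (Fin (n + 1)) ℂ}
    (hF : F.IsHomogeneous d) :
    disEval D (linSubst (Matrix.transvection i j t) F) = disEval D F := by
  have hdet : ∀ s : ℂ, (Matrix.transvection i j s).det ≠ 0 := fun s => by
    rw [Matrix.det_transvection_of_ne i j hij]
    exact one_ne_zero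
  have hF₀ := isHomogeneous_diagForm d (1 : Fin (n + 1) → ℂ)
  have hns := not_hasSingularPoint_diagForm hd (c := (1 : Fin (n + 1) → ℂ)) (by simp)
  obtain ⟨q, hq⟩ := exists_eval_eq_disEval_map D
    (linSubst (Matrix.transvection i j Polynomial.X) (diagForm d (1 : Fin (n + 1) → Polynomial ℂ)))
  have hq' : ∀ s, q.eval s = disEval D (linSubst (Matrix.transvection i j s) (diagForm d 1)) := by
    intro s
    rw [← hq, map_linSubst, map_diagForm]
    congr 3
    · ext a b
      simp only [Matrix.transvection, Matrix.map_apply, Matrix.add_apply, Matrix.single_apply,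
        Matrix.one_apply]
      split_ifs <;> simp
    · ext; simp
  have hdeg : q.degree = 0 := by
    by_contra hdeg
    obtain ⟨s, hs⟩ := IsAlgClosed.exists_root q hdeg
    rw [Polynomial.IsRoot, hq'] at hs
    exact hD.disEval_ne_zero (hF₀.linSubst _)
      (fun h => hns ((hasSingularPoint_linSubst_iff (hdet s)).1 h)) hs
  have hconst : q.eval t = q.eval 0 := by
    rw [Polynomial.eq_C_of_degree_eq_zero hdeg, Polynomial.eval_C, Polynomial.eval_C]
  obtain ⟨c, hc⟩ := hD.exists_disEval_linSubst (hdet t)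
  rw [hq', hq', Matrix.transvection_zero, linSubst_one, hc _ hF₀,
    mul_eq_right₀ (hD.disEval_ne_zero hF₀ hns)] at hconst
  rw [hc _ hF, hconst, one_mul]

lemma IsDiscriminant.exponent_le (hD : IsDiscriminant n d D) (hd : 2 ≤ d) (i : Fin (n + 1))
    {k : ℂ} {m : ℕ} (hk : k ≠ 0)
    (h : ∀ s : ℂ, disEval D (diagForm d (Pi.mulSingle i s)) = k * s ^ m) : m ≤ (d - 1) ^ n := by
  classical
  have hdvd : D ∣ (macaulayMatrix d i (universalForm (n + 1) d)).det := by
    refine hD.dvd fun F hF hs => ?_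
    have hU := map_universalForm fun α : Mono (n + 1) d => coeff α.toFinsupp F
    rw [formOf_coeff hF] at hU
    rw [← det_macaulayMatrix_eq_zero hd i hF hs, ← hU, ← map_macaulayMatrix, hU]
    exact RingHom.map_det (aeval fun α : Mono (n + 1) d => coeff α.toFinsupp F :
      _ →ₐ[ℂ] ℂ).toRingHom _
  set c : Fin (n + 1) → Polynomial ℂ := Pi.mulSingle i Polynomial.X with hc
  set φ : MvPolynomial (Mono (n + 1) d) ℂ →ₐ[ℂ] Polynomial ℂ :=
    aeval fun α => coeff α.toFinsupp (diagForm d c) with hφ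
  have hφU : map φ.toRingHom (universalForm (n + 1) d) = diagForm d c := by
    rw [universalForm, map_formOf, ← formOf_coeff (isHomogeneous_diagForm d c)]
    congr 1
    ext1 α
    simp [hφ]
  have hφD : φ D = Polynomial.C k * Polynomial.X ^ m := by
    refine Polynomial.funext fun s => ?_
    have := disEval_map (Polynomial.aeval s) D (diagForm d c)
    have hs : (Polynomial.aeval s : _ →ₐ[ℂ] ℂ).toRingHom ∘ c = Pi.mulSingle i s := by
      ext1 j
      by_cases hj : j = i
      · subst hj; simp [hc]
      · simp [hc, hj]
    rw [map_diagForm, hs, h] at this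
    simpa using this.symm
  have hφM : φ (macaulayMatrix d i (universalForm (n + 1) d)).det =
      ∏ α : Mono (n + 1) (macaulayDegree n d), ((d : Polynomial ℂ) * c (macaulayIndex d i α.1)) := by
    have := RingHom.map_det φ.toRingHom (macaulayMatrix d i (universalForm (n + 1) d))
    rw [RingHom.mapMatrix_apply, map_macaulayMatrix, hφU, macaulayMatrix_diagForm hd,
      Matrix.det_diagonal] at this
    exact this
  have hdvd' := map_dvd φ hdvd
  have hprod : ∏ α : Mono (n + 1) (macaulayDegree n d), c (macaulayIndex d i α.1) =
      Polynomial.X ^ (Finset.univ.filter fun α : Mono (n + 1) (macaulayDegree n d) =>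
        macaulayIndex d i α.1 = i).card := by
    simp only [hc, Pi.mulSingle_apply, Finset.prod_ite, Finset.prod_const, one_pow,
      mul_one]
  have hd0 : (d : ℂ) ≠ 0 := by
    rw [Nat.cast_ne_zero]
    omega
  rw [hφD, hφM, Finset.prod_mul_distrib, hprod, Finset.prod_const, ← Polynomial.C_eq_natCast,
    ← Polynomial.C_pow] at hdvd'
  have hle := Polynomial.natDegree_le_of_dvd hdvd' (mul_ne_zero
    (Polynomial.C_ne_zero.2 (pow_ne_zero _ hd0)) (pow_ne_zero _ Polynomial.X_ne_zero))
  rw [Polynomial.natDegree_C_mul_X_pow _ _ hk,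
    Polynomial.natDegree_C_mul_X_pow _ _ (pow_ne_zero _ hd0)] at hle
  exact hle.trans (card_macaulayIndex_eq_le _ i)

lemma IsDiscriminant.disEval_linSubst_mulSingle (hD : IsDiscriminant n d D) {i : Fin (n + 1)}
    {k : ℂ} {m : ℕ} (hk : k ≠ 0)
    (h : ∀ s : ℂ, disEval D (diagForm d (Pi.mulSingle i s)) = k * s ^ m) {s : ℂ} (hs : s ≠ 0)
    {F : MvPolynomial (Fin (n + 1)) ℂ} (hF : F.IsHomogeneous d) :
    disEval D (linSubst (Matrix.diagonal (Pi.mulSingle i s)) F) = s ^ (d * m) * disEval D F := by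
  have hdet : (Matrix.diagonal (Pi.mulSingle i s)).det ≠ 0 := by
    rwa [Matrix.det_diagonal, Finset.prod_pi_mulSingle', if_pos (Finset.mem_univ i)]
  obtain ⟨c, hc⟩ := hD.exists_disEval_linSubst hdet
  have h1 := hc _ (isHomogeneous_diagForm d (1 : Fin (n + 1) → ℂ))
  have hpow : (fun j => (Pi.mulSingle i s : Fin (n + 1) → ℂ) j ^ d * (1 : Fin (n + 1) → ℂ) j) =
      Pi.mulSingle i (s ^ d) := by
    ext j
    by_cases hj : j = i
    · subst hj; simp
    · simp [hj]
  rw [linSubst_diagonal_diagForm, hpow, ← Pi.mulSingle_one i, h, h, one_pow, mul_one, mul_comm,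
    ← pow_mul] at h1
  rw [hc _ hF, mul_right_cancel₀ hk h1]

lemma exists_injective_sum_mul {ι Z : Type*} [Finite Z] [Fintype ι] {z : Z → ι → ℂ}
    (hz : Function.Injective z) :
    ∃ β : ι → ℂ, (∀ j, β j ≠ 0) ∧ Function.Injective fun w => ∑ j, β j * z w j := by
  classical
  obtain ⟨f, hf⟩ := Module.exists_dual_forall_apply_ne_zero (K := ℂ)
    (Sum.elim (fun j : ι => (Pi.single j 1 : ι → ℂ))
      fun p : {p : Z × Z // p.1 ≠ p.2} => z p.1.1 - z p.1.2) (by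
    rintro (j | p)
    · simp
    · simpa [sub_eq_zero] using hz.ne p.2)
  have hsum : ∀ v : ι → ℂ, ∑ j, f (Pi.single j 1) * v j = f v := fun v => by
    conv_rhs => rw [pi_eq_sum_univ' v]
    simp [mul_comm]
  refine ⟨fun j => f (Pi.single j 1), fun j => hf (Sum.inl j), fun w w' hw => ?_⟩
  by_contra hne
  refine hf (Sum.inr ⟨(w, w'), hne⟩) ?_
  simp only [hsum] at hw
  simp [hw]

section Pencil

variable {R : Type*} [CommRing R]

/-- The form `t x_i^d + ∑_{j ≠ i} β_j (x_j^d - d a x_j x_i^{d-1})`. -/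
noncomputable def pencil (d : ℕ) (i : Fin (n + 1)) (β : Fin n → R) (a t : R) :
    MvPolynomial (Fin (n + 1)) R :=
  C t * X i ^ d +
    ∑ j, C (β j) * (X (i.succAbove j) ^ d - C (d * a) * (X (i.succAbove j) * X i ^ (d - 1)))

lemma isHomogeneous_pencil (hd : 2 ≤ d) (i : Fin (n + 1)) (β : Fin n → R) (a t : R) :
    (pencil d i β a t).IsHomogeneous d := by
  have hC : ∀ (r : R) {P : MvPolynomial (Fin (n + 1)) R}, P.IsHomogeneous d →
      (C r * P).IsHomogeneous d := fun r P hP => by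
    simpa only [zero_add] using (isHomogeneous_C _ r).mul hP
  have hX : ∀ j, ((X j : MvPolynomial (Fin (n + 1)) R) ^ d).IsHomogeneous d := fun j => by
    simpa only [one_mul] using (isHomogeneous_X R j).pow d
  refine (hC _ (hX i)).add (IsHomogeneous.sum _ _ _ fun j _ => hC _ ((hX _).sub (hC _ ?_)))
  have := (isHomogeneous_X R (i.succAbove j)).mul ((isHomogeneous_X R i).pow (d - 1))
  rwa [one_mul, Nat.add_sub_cancel' (by omega : 1 ≤ d)] at this

lemma map_pencil {S : Type*} [CommRing S] (φ : R →+* S) (i : Fin (n + 1)) (β : Fin n → R)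
    (a t : R) : map φ (pencil d i β a t) = pencil d i (φ ∘ β) (φ a) (φ t) := by
  simp [pencil]

lemma pencil_zero_one (i : Fin (n + 1)) (β : Fin n → R) :
    pencil d i β 0 1 = diagForm d (i.insertNth 1 β : Fin (n + 1) → R) := by
  simp [pencil, diagForm, Fin.sum_univ_succAbove _ i]

lemma linSubst_pencil (i : Fin (n + 1)) (β : Fin n → R) (a t s : R) :
    linSubst (Matrix.diagonal (Pi.mulSingle i s)) (pencil d i β a t) =
      pencil d i β (a * s ^ (d - 1)) (t * s ^ d) := by
  simp only [pencil, map_add, map_mul, map_sum, map_sub, map_pow, linSubst_C,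
    linSubst_diagonal_X, Pi.mulSingle_eq_same, Pi.mulSingle_eq_of_ne (i.succAbove_ne _), C_1,
    one_mul, mul_pow]
  congr 1
  · ring
  · exact Finset.sum_congr rfl fun j _ => by ring

lemma hasSingularPoint_pencil [Nontrivial R] (i : Fin (n + 1)) (β ζ : Fin n → R)
    (hd : 2 ≤ d) (hζ : ∀ j, ζ j ^ (d - 1) = 1) :
    HasSingularPoint (pencil d i β 1 ((d - 1) * ∑ j, β j * ζ j)) := by
  refine ⟨(i.insertNth 1 ζ : Fin (n + 1) → R), fun h => ?_, fun l => ?_⟩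
  · simpa using congrFun h i
  · have hcast : ((d - 1 : ℕ) : R) = (d : R) - 1 := by
      rw [Nat.cast_sub (by omega), Nat.cast_one]
    rcases Fin.eq_self_or_eq_succAbove i l with rfl | ⟨l, rfl⟩
    · simp only [pencil, map_add, map_sum, map_sub, pderiv_mul, pderiv_C, pderiv_pow,
        pderiv_X_self, pderiv_X_of_ne (l.succAbove_ne _), zero_mul, mul_zero, zero_add, zero_sub]
      simp only [map_sum, map_mul, map_neg, map_pow, eval_C, eval_X,
        Fin.insertNth_apply_same, Fin.insertNth_apply_succAbove, map_natCast,
        one_pow, mul_one, hcast, Finset.mul_sum]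
      rw [Finset.sum_mul, ← Finset.sum_add_distrib]
      exact Finset.sum_eq_zero fun j _ => by ring
    · have hne : ∀ j, j ≠ l → i.succAbove j ≠ i.succAbove l := fun j hj =>
        i.succAbove_right_injective.ne hj
      simp only [pencil, map_add, map_sum, map_sub, pderiv_mul, pderiv_C, pderiv_pow,
        pderiv_X_of_ne (i.succAbove_ne l).symm, zero_mul, mul_zero, zero_add, add_zero]
      refine Finset.sum_eq_zero fun j _ => ?_
      by_cases hj : j = l
      · subst hj
        simp [hζ]
      · simp [pderiv_X_of_ne (hne j hj)]

end Pencil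

lemma IsDiscriminant.le_exponent (hD : IsDiscriminant n d D) (hd : 2 ≤ d) (i : Fin (n + 1))
    {k : ℂ} {m : ℕ} (hk : k ≠ 0)
    (h : ∀ s : ℂ, disEval D (diagForm d (Pi.mulSingle i s)) = k * s ^ m) : (d - 1) ^ n ≤ m := by
  classical
  have : NeZero (d - 1) := ⟨by omega⟩
  let _ : Fintype (rootsOfUnity (d - 1) ℂ) := Fintype.ofFinite _
  let z : (Fin n → rootsOfUnity (d - 1) ℂ) → Fin n → ℂ := fun w j => ((w j : ℂˣ) : ℂ)
  have hz : Function.Injective z := fun w w' hw => funext fun j =>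
    Subtype.ext (Units.ext (congrFun hw j))
  obtain ⟨β, hβ, hinj⟩ := exists_injective_sum_mul hz
  have hmap : ∀ (f g : Polynomial ℂ) (s : ℂ), map (Polynomial.evalRingHom s)
      (pencil d i (fun j => Polynomial.C (β j)) f g) = pencil d i β (f.eval s) (g.eval s) := by
    intro f g s
    rw [map_pencil]
    congr 1
    ext; simp
  obtain ⟨q, hq⟩ := exists_eval_eq_disEval_map D
    (pencil d i (fun j => Polynomial.C (β j)) 1 Polynomial.X)
  obtain ⟨r, hr⟩ := exists_eval_eq_disEval_map D
    (pencil d i (fun j => Polynomial.C (β j)) (Polynomial.X ^ (d - 1)) 1)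
  simp only [hmap, Polynomial.eval_one, Polynomial.eval_X, Polynomial.eval_pow] at hq hr
  have hr0 : r.eval 0 ≠ 0 := by
    rw [← hr, zero_pow (by omega), pencil_zero_one]
    refine hD.disEval_diagForm_ne_zero hd fun l => ?_
    rcases Fin.eq_self_or_eq_succAbove i l with rfl | ⟨l, rfl⟩
    · simp
    · simpa using hβ l
  have hrq : ∀ s : ℂ, s ≠ 0 → r.eval s = (s ^ d) ^ m * q.eval (s ^ d)⁻¹ := by
    intro s hs
    rw [← hr, ← hq, ← pow_mul, ← hD.disEval_linSubst_mulSingle hk h hs (isHomogeneous_pencil hd ..),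
      linSubst_pencil, one_mul, inv_mul_cancel₀ (pow_ne_zero _ hs)]
  have hq0 : q ≠ 0 := by
    rintro rfl
    refine hr0 ?_
    have : Polynomial.X * r = Polynomial.X * 0 := Polynomial.funext fun s => by
      rcases eq_or_ne s 0 with rfl | hs
      · simp
      · simp [hrq s hs]
    rw [mul_left_cancel₀ Polynomial.X_ne_zero this, Polynomial.eval_zero]
  have hdeg : q.natDegree ≤ m := by
    by_contra! hlt
    have hpoly : Polynomial.X * (Polynomial.expand ℂ d q.reverse) =
        Polynomial.X * (Polynomial.X ^ (d * (q.natDegree - m)) * r) := by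
      refine Polynomial.funext fun s => ?_
      rcases eq_or_ne s 0 with rfl | hs
      · simp
      · have hsd : s ^ d ≠ 0 := pow_ne_zero _ hs
        let _ := invertibleOfNonzero (inv_ne_zero hsd)
        have hrev := Polynomial.eval₂_reverse_mul_pow (RingHom.id ℂ) (s ^ d)⁻¹ q
        simp only [invOf_eq_inv, inv_inv, Polynomial.eval₂_id] at hrev
        simp only [Polynomial.eval_mul, Polynomial.eval_X, Polynomial.expand_eval,
          Polynomial.eval_pow, hrq s hs, ← hrev]
        rw [pow_mul, ← mul_assoc ((s ^ d) ^ _), ← pow_add, Nat.sub_add_cancel hlt.le, inv_pow,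
          mul_left_comm ((s ^ d) ^ _), mul_inv_cancel₀ (pow_ne_zero _ hsd), mul_one]
    have h0 := congrArg (Polynomial.eval 0) (mul_left_cancel₀ Polynomial.X_ne_zero hpoly)
    rw [Polynomial.expand_eval, zero_pow (by omega), ← Polynomial.coeff_zero_eq_eval_zero,
      Polynomial.coeff_zero_reverse, Polynomial.eval_mul, Polynomial.eval_pow, Polynomial.eval_X,
      zero_pow (Nat.mul_ne_zero (by omega) (by omega)), zero_mul,
      Polynomial.leadingCoeff_eq_zero] at h0
    exact hq0 h0
  let τ : (Fin n → rootsOfUnity (d - 1) ℂ) → ℂ := fun w => ((d : ℂ) - 1) * ∑ j, β j * z w j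
  have hτ : Function.Injective τ := fun w w' hw => hinj (mul_left_cancel₀ (by
    rw [sub_ne_zero]
    exact_mod_cast (by omega : d ≠ 1)) hw)
  have hroot : ∀ w, τ w ∈ q.roots.toFinset := by
    intro w
    rw [Multiset.mem_toFinset, Polynomial.mem_roots hq0, Polynomial.IsRoot, ← hq]
    refine (hD.1 _ (isHomogeneous_pencil hd ..)).1 (hasSingularPoint_pencil i β (z w) hd fun j => ?_)
    have := congrArg Units.val ((mem_rootsOfUnity _ _).1 (w j).2)
    simpa only [Units.val_pow_eq_pow_val, Units.val_one] using this
  calc (d - 1) ^ n = Fintype.card (Fin n → rootsOfUnity (d - 1) ℂ) := by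
        rw [Fintype.card_fun, Fintype.card_fin, ← Nat.card_eq_fintype_card,
          Complex.card_rootsOfUnity]
    _ = (Finset.univ.image τ).card := (Finset.card_image_of_injective _ hτ).symm
    _ ≤ q.roots.toFinset.card := Finset.card_le_card fun _ hx => by
        obtain ⟨w, -, rfl⟩ := Finset.mem_image.1 hx
        exact hroot w
    _ ≤ q.natDegree := (Multiset.toFinset_card_le _).trans q.card_roots'
    _ ≤ m := hdeg

lemma IsDiscriminant.disEval_linSubst_diagonal_mulSingle (hD : IsDiscriminant n d D) (hd : 2 ≤ d)
    (i : Fin (n + 1)) {s : ℂ} (hs : s ≠ 0) {F : MvPolynomial (Fin (n + 1)) ℂ}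
    (hF : F.IsHomogeneous d) :
    disEval D (linSubst (Matrix.diagonal (Pi.mulSingle i s)) F) =
      s ^ (d * (d - 1) ^ n) * disEval D F := by
  obtain ⟨p, hp⟩ := exists_eval_eq_disEval_map D (diagForm d (Pi.mulSingle i Polynomial.X))
  have hp' : ∀ s : ℂ, disEval D (diagForm d (Pi.mulSingle i s)) = p.eval s := by
    intro s
    rw [← hp, map_diagForm]
    congr 2
    ext j
    by_cases hj : j = i
    · subst hj; simp
    · simp [hj]
  obtain ⟨k, hk, m, rfl⟩ := Polynomial.exists_eq_C_mul_X_pow (p := p) fun s hs => by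
    rw [← hp']
    refine hD.disEval_diagForm_ne_zero hd fun j => ?_
    by_cases hj : j = i
    · subst hj; simpa using hs
    · simp [hj]
  simp only [Polynomial.eval_mul, Polynomial.eval_C, Polynomial.eval_pow, Polynomial.eval_X] at hp'
  rw [hD.disEval_linSubst_mulSingle hk hp' hs hF,
    le_antisymm (hD.exponent_le hd i hk hp') (hD.le_exponent hd i hk hp')]

lemma IsDiscriminant.disEval_linSubst (hD : IsDiscriminant n d D) (hd : 2 ≤ d)
    (A : Matrix (Fin (n + 1)) (Fin (n + 1)) ℂ) {F : MvPolynomial (Fin (n + 1)) ℂ}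
    (hF : F.IsHomogeneous d) :
    disEval D (linSubst A F) = A.det ^ (d * (d - 1) ^ n) * disEval D F := by
  rcases eq_or_ne A.det 0 with hA | hA
  · rw [hA, zero_pow (Nat.mul_ne_zero (by omega) (pow_ne_zero _ (by omega))), zero_mul]
    exact (hD.1 _ (hF.linSubst A)).1 (hasSingularPoint_linSubst_of_det_eq_zero hA hF hd)
  let P : Matrix (Fin (n + 1)) (Fin (n + 1)) ℂ → Prop := fun B =>
    ∀ G : MvPolynomial (Fin (n + 1)) ℂ, G.IsHomogeneous d →
      disEval D (linSubst B G) = B.det ^ (d * (d - 1) ^ n) * disEval D G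
  have hmul : ∀ B B', P B → P B' → P (B * B') := by
    intro B B' hB hB' G hG
    rw [linSubst_mul, hB' _ (hG.linSubst B), hB _ hG, Matrix.det_mul, mul_pow]
    ring
  refine Matrix.diagonal_transvection_induction_of_det_ne_zero P A hA ?_ ?_
    (fun B B' _ _ => hmul B B') F hF
  · intro s hs
    rw [Matrix.det_diagonal, Finset.prod_ne_zero_iff] at hs
    rw [← Finset.univ_prod_mulSingle s]
    refine Finset.prod_induction _ (fun v => P (Matrix.diagonal v)) ?_ ?_ ?_
    · intro v w hv hw
      have hvw : Matrix.diagonal (v * w) = Matrix.diagonal v * Matrix.diagonal w := by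
        rw [Matrix.diagonal_mul_diagonal]
        rfl
      rw [hvw]
      exact hmul _ _ hv hw
    · intro G _
      rw [Pi.one_def, Matrix.diagonal_one, linSubst_one, Matrix.det_one, one_pow, one_mul]
    · intro i hi G hG
      rw [hD.disEval_linSubst_diagonal_mulSingle hd i (hs i hi) hG, Matrix.det_diagonal,
        Finset.prod_pi_mulSingle', if_pos hi]
  · intro t G hG
    rw [t.det, one_pow, one_mul]
    exact hD.disEval_linSubst_transvection hd t.hij t.c hG

end Exponent

section DegreeOne

variable {R : Type*} [CommRing R] {σ : Type*} [Fintype σ]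

lemma diagForm_one_coeff {F : MvPolynomial σ R} (hF : F.IsHomogeneous 1) :
    diagForm 1 (fun j => coeff (Finsupp.single j 1) F) = F := by
  classical
  ext s
  by_cases hs : Finsupp.degree s = 1
  · obtain ⟨i, rfl⟩ := (Finsupp.sum_eq_one_iff s).1 hs
    simp [diagForm, coeff_sum, coeff_C_mul, coeff_X, Finsupp.single_left_inj]
  · rw [hF.coeff_eq_zero hs, (isHomogeneous_diagForm _ _).coeff_eq_zero hs]

lemma eval_pderiv_of_isHomogeneous_one {F : MvPolynomial σ R} (hF : F.IsHomogeneous 1) (i : σ)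
    (x : σ → R) : eval x (pderiv i F) = coeff (Finsupp.single i 1) F := by
  conv_lhs => rw [← diagForm_one_coeff hF, pderiv_diagForm]
  simp

lemma IsDiscriminant.disEval_linSubst_of_degree_one {n : ℕ}
    {D : MvPolynomial (Mono (n + 1) 1) ℂ} (hD : IsDiscriminant n 1 D)
    (A : Matrix (Fin (n + 1)) (Fin (n + 1)) ℂ) {F : MvPolynomial (Fin (n + 1)) ℂ}
    (hF : F.IsHomogeneous 1) : disEval D (linSubst A F) = A.det ^ 0 ^ n * disEval D F := by
  let α : Mono (n + 1) 1 := ⟨Finsupp.single 0 1, by simp [Finsupp.single_apply]⟩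
  have hα : α.toFinsupp = Finsupp.single 0 1 := by ext; rfl
  have hdvd : D ∣ X α := hD.dvd fun G hG ⟨x, _, hx⟩ => by
    rw [disEval, eval_X, hα, ← eval_pderiv_of_isHomogeneous_one hG 0 x, hx]
  obtain ⟨E, hE⟩ := hdvd
  obtain ⟨c, hc, rfl⟩ := isUnit_iff_eq_C_of_isReduced.1
    (((X_prime (i := α)).irreducible.isUnit_or_isUnit hE).resolve_left hD.2.not_isUnit)
  have hcoeff : ∀ G, coeff (Finsupp.single 0 1) G = disEval D G * c := fun G => by
    have := congrArg (fun P => disEval P G) hE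
    simpa [disEval, hα] using this
  rcases n with _ | n
  · refine mul_right_cancel₀ hc.ne_zero ?_
    have hA : A = Matrix.diagonal fun _ => A 0 0 := by
      ext i j
      fin_cases i; fin_cases j; rfl
    rw [mul_assoc, ← hcoeff, ← hcoeff, hA, ← diagForm_one_coeff hF, linSubst_diagonal_diagForm]
    simp [diagForm, mul_assoc, coeff_C_mul]
  · have h1 : disEval D (X 1) = 0 := by
      have := hcoeff (X 1)
      rw [coeff_X, if_neg (by simp [Finsupp.single_left_inj])] at this
      exact (mul_eq_zero.1 this.symm).resolve_right hc.ne_zero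
    obtain ⟨x, -, hx⟩ := (hD.1 _ (isHomogeneous_X ℂ 1)).2 h1
    simpa using hx 1

end DegreeOne

/-- Invariance of the discriminant: for every homogeneous `F` of degree `d` and every
`(n+1) × (n+1)` complex matrix `A`, `Dis(F(A x)) = det(A)^{d(d-1)^n} ⬝ Dis(F(x))`, where
`F(A x)` is obtained from `F` by the linear substitution `x_j ↦ ∑_k A_{jk} x_k`. -/
theorem discriminant_invariance (n d : ℕ) (hd : 0 < d)
    (D : MvPolynomial (Mono (n + 1) d) ℂ) (hD : IsDiscriminant n d D)
    (F : MvPolynomial (Fin (n + 1)) ℂ) (hF : F.IsHomogeneous d)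
    (A : Matrix (Fin (n + 1)) (Fin (n + 1)) ℂ) :
    disEval D ((aeval fun j => ∑ k, C (A j k) * (X k : MvPolynomial (Fin (n + 1)) ℂ)) F) =
      A.det ^ (d * (d - 1) ^ n) * disEval D F := by
  rcases Nat.lt_or_ge 1 d with h | h
  · exact hD.disEval_linSubst h A hF
  · obtain rfl : d = 1 := by omega
    rw [one_mul]
    exact hD.disEval_linSubst_of_degree_one A hF
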